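/- Let F_0, …, F_m be homogeneous polynomials in ℂ[x_0, …, x_n] of degrees d_0, …, d_m > 0, and let λ = (λ_0, …, λ_m), ν = (ν_0, …, ν_m) ∈ (ℂ*)^{m+1} satisfy Σ λ_i d_i = Σ ν_i d_i = 0. If the 1-forms ω_λ = Σ_i λ_i F_0⋯\hat{F_i}⋯F_m dF_i and ω_ν = Σ_i ν_i F_0⋯\hat{F_i}⋯F_m dF_i are proportional as elements of the module of Kähler differentials (i.e., ω_ν = c·ω_λ for some c ∈ ℂ*), and the F_i are algebraically independent with m ≥ 1, then λ and ν are proportional. -/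

import Mathlib

open scoped IntermediateField.algebraAdjoinAdjoin in
/-- In characteristic zero, a field is formally étale over the polynomial ring on a transcendence
basis. -/
lemma IsTranscendenceBasis.formallyEtale_aeval {k K ι : Type*} [Field k] [CharZero k] [Field K]
    [Algebra k K] {x : ι → K} (hx : IsTranscendenceBasis k x) :
    letI := (MvPolynomial.aeval (R := k) x).toAlgebra
    Algebra.FormallyEtale (MvPolynomial ι k) K := by
  let := (MvPolynomial.aeval (R := k) x).toAlgebra
  let : Algebra (MvPolynomial ι k) (Algebra.adjoin k (Set.range x)) :=
    hx.1.aevalEquiv.toAlgHom.toAlgebra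
  have : IsScalarTower (MvPolynomial ι k) (Algebra.adjoin k (Set.range x)) K :=
    .of_algebraMap_eq fun p ↦ (hx.1.algebraMap_aevalEquiv p).symm
  have : Algebra.FormallyEtale (MvPolynomial ι k) (Algebra.adjoin k (Set.range x)) :=
    .of_equiv (AlgEquiv.ofBijective (Algebra.ofId _ _) hx.1.aevalEquiv.bijective)
  have : Algebra.FormallyEtale (Algebra.adjoin k (Set.range x))
      (IntermediateField.adjoin k (Set.range x)) := .of_isLocalization (nonZeroDivisors _)
  have := hx.isAlgebraic_field
  have : Algebra.FormallyEtale (IntermediateField.adjoin k (Set.range x)) K := .of_isSeparable _ _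
  have : Algebra.FormallyEtale (Algebra.adjoin k (Set.range x)) K :=
    .comp _ (IntermediateField.adjoin k (Set.range x)) _
  exact .comp _ (Algebra.adjoin k (Set.range x)) _

/-- The differentials of a transcendence basis are linearly independent in characteristic zero. -/
lemma IsTranscendenceBasis.linearIndependent_D {k K ι : Type*} [Field k] [CharZero k] [Field K]
    [Algebra k K] {x : ι → K} (hx : IsTranscendenceBasis k x) :
    LinearIndependent K fun i ↦ KaehlerDifferential.D k K (x i) := by
  let := (MvPolynomial.aeval (R := k) x).toAlgebra
  have : IsScalarTower k (MvPolynomial ι k) K :=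
    .of_algebraMap_eq fun r ↦ (MvPolynomial.aeval_C x r).symm
  have := hx.formallyEtale_aeval
  let b := ((KaehlerDifferential.mvPolynomialBasis k ι).baseChange K).map
    (KaehlerDifferential.tensorKaehlerEquivOfFormallyEtale k (MvPolynomial ι k) K)
  convert b.linearIndependent with i
  have hX : algebraMap (MvPolynomial ι k) K (MvPolynomial.X i) = x i := MvPolynomial.aeval_X x i
  simp [b, KaehlerDifferential.mvPolynomialBasis_apply, hX]

/-- The differentials of an algebraically independent family in a domain of characteristic zero
are linearly independent. -/
lemma AlgebraicIndependent.linearIndependent_D {k A ι : Type*} [Field k] [CharZero k] [CommRing A]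
    [IsDomain A] [Algebra k A] {x : ι → A} (hx : AlgebraicIndependent k x) :
    LinearIndependent A fun i ↦ KaehlerDifferential.D k A (x i) := by
  let K := FractionRing A
  have hK : AlgebraicIndependent k (algebraMap A K ∘ x) :=
    hx.map' (f := IsScalarTower.toAlgHom k A K) (IsFractionRing.injective A K)
  obtain ⟨t, hst, ht⟩ := exists_isTranscendenceBasis_superset hK.coe_range
  have hD : LinearIndependent K fun i ↦ KaehlerDifferential.D k K (algebraMap A K (x i)) :=
    ht.linearIndependent_D.comp (fun i ↦ ⟨algebraMap A K (x i), hst ⟨i, rfl⟩⟩)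
      fun i j h ↦ hK.injective (congrArg Subtype.val h)
  refine .of_comp (KaehlerDifferential.map k k A K) ?_
  convert hD.restrict_scalars (R := A) ?_ using 1
  · ext i
    simp
  · intro a b h
    simpa [Algebra.smul_def] using h


open MvPolynomial in
/-- Logarithmic 1-forms with non-proportional coefficient vectors are non-proportional.
Let `F_0, …, F_m ∈ ℂ[x_0, …, x_n]` be homogeneous of degrees `d_i > 0`, algebraically
independent, with `m ≥ 1`, and let `λ, ν ∈ (ℂ^*)^{m+1}` satisfy `Σ λ_i d_i = Σ ν_i d_i = 0`.
If the logarithmic forms `ω_λ = Σ_i λ_i F_0 ⋯ \hat{F_i} ⋯ F_m dF_i` and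
`ω_ν = Σ_i ν_i F_0 ⋯ \hat{F_i} ⋯ F_m dF_i` are proportional in the module of Kähler
differentials `Ω_{ℂ[x]/ℂ}` (i.e. `ω_ν = c • ω_λ` with `c ∈ ℂ^*`), then `ν = t • λ` for
some `t ∈ ℂ^*`. -/
theorem stmt_8 (n m : ℕ) (hm : 1 ≤ m)
    (F : Fin (m + 1) → MvPolynomial (Fin (n + 1)) ℂ)
    (d : Fin (m + 1) → ℕ) (hd : ∀ i, 0 < d i)
    (hF : ∀ i, (F i).IsHomogeneous (d i))
    (hindep : AlgebraicIndependent ℂ F)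
    (lam nu : Fin (m + 1) → ℂ)
    (hlam : ∀ i, lam i ≠ 0) (hnu : ∀ i, nu i ≠ 0)
    (hslam : ∑ i, lam i * (d i : ℂ) = 0) (hsnu : ∑ i, nu i * (d i : ℂ) = 0)
    (c : ℂ) (hc : c ≠ 0)
    (hprop :
      ∑ i, ((C (nu i) * ∏ j ∈ Finset.univ.erase i, F j :
              MvPolynomial (Fin (n + 1)) ℂ)) •
          (KaehlerDifferential.D ℂ (MvPolynomial (Fin (n + 1)) ℂ) (F i)) =
        (C c : MvPolynomial (Fin (n + 1)) ℂ) •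
          ∑ i, ((C (lam i) * ∏ j ∈ Finset.univ.erase i, F j :
              MvPolynomial (Fin (n + 1)) ℂ)) •
            (KaehlerDifferential.D ℂ (MvPolynomial (Fin (n + 1)) ℂ) (F i))) :
    ∃ t : ℂ, t ≠ 0 ∧ nu = t • lam := by
  have hne : ∀ i, ∏ j ∈ Finset.univ.erase i, F j ≠ 0 := fun i ↦
    Finset.prod_ne_zero_iff.mpr fun j _ ↦ hindep.ne_zero j
  have hzero : ∑ i, ((C (nu i - c * lam i) * ∏ j ∈ Finset.univ.erase i, F j :
      MvPolynomial (Fin (n + 1)) ℂ)) •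
        (KaehlerDifferential.D ℂ (MvPolynomial (Fin (n + 1)) ℂ) (F i)) = 0 := by
    rw [← sub_eq_zero, Finset.smul_sum, ← Finset.sum_sub_distrib] at hprop
    rw [← hprop]
    refine Finset.sum_congr rfl fun i _ ↦ ?_
    rw [smul_smul, ← sub_smul, C_sub, C_mul]
    congr 1
    ring
  refine ⟨c, hc, funext fun i ↦ ?_⟩
  have hi := Fintype.linearIndependent_iff.mp hindep.linearIndependent_D _ hzero i
  have hCi := (mul_eq_zero.mp hi).resolve_right (hne i)
  rw [C_eq_zero, sub_eq_zero] at hCi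
  simpa using hCi
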